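/- Let g₁,…,g_l be homogeneous polynomials on ℂ^l whose Jacobian determinant det(∂g_i/∂x_j) is not identically zero, and let C ⊆ GL(ℂ^l) be a finite reflection group such that each g_i is C-invariant and the degrees of g₁,…,g_l multiply to |C| (equivalently, equal the fundamental degrees of C). Then ℂ[x₁,…,x_l]^C = ℂ[g₁,…,g_l]. -/

import Mathlib

open MvPolynomial Module

/-- The linear substitution action of an invertible matrix on polynomials:
`(M • f)(x) = f(Mx)`. -/
noncomputable def matrixSubst {l : ℕ} (M : Matrix (Fin l) (Fin l) ℂ)
    (f : MvPolynomial (Fin l) ℂ) : MvPolynomial (Fin l) ℂ :=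
  aeval (fun i => ∑ j, M i j • (X j : MvPolynomial (Fin l) ℂ)) f

namespace Springer

/-- the substitution as an algebra homomorphism -/
noncomputable def sb {l : ℕ} (M : Matrix (Fin l) (Fin l) ℂ) :
    MvPolynomial (Fin l) ℂ →ₐ[ℂ] MvPolynomial (Fin l) ℂ :=
  aeval (fun i => ∑ j, M i j • (X j : MvPolynomial (Fin l) ℂ))

lemma sb_X {l : ℕ} (M : Matrix (Fin l) (Fin l) ℂ) (i : Fin l) :
    sb M (X i) = ∑ j, M i j • (X j : MvPolynomial (Fin l) ℂ) := by simp [sb]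

lemma sb_comp {l : ℕ} (M N : Matrix (Fin l) (Fin l) ℂ) :
    (sb M).comp (sb N) = sb (N * M) := by
  apply MvPolynomial.algHom_ext
  intro i
  simp only [AlgHom.comp_apply, sb_X, map_sum, map_smul, Matrix.mul_apply, Finset.sum_smul,
    Finset.smul_sum, smul_smul]
  rw [Finset.sum_comm]

lemma sb_sb {l : ℕ} (M N : Matrix (Fin l) (Fin l) ℂ) (f : MvPolynomial (Fin l) ℂ) :
    sb M (sb N f) = sb (N * M) f := by rw [← sb_comp]; rfl

lemma sb_one {l : ℕ} (f : MvPolynomial (Fin l) ℂ) :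
    sb (1 : Matrix (Fin l) (Fin l) ℂ) f = f := by
  have : sb (1 : Matrix (Fin l) (Fin l) ℂ) = AlgHom.id ℂ _ := by
    apply MvPolynomial.algHom_ext
    intro i
    simp [sb_X, Matrix.one_apply]
  rw [this]; rfl

lemma sb_hom {l : ℕ} (M : Matrix (Fin l) (Fin l) ℂ) {f : MvPolynomial (Fin l) ℂ} {k : ℕ}
    (hf : f.IsHomogeneous k) : (sb M f).IsHomogeneous k := by
  have := hf.aeval (n := 1) (fun i => ∑ j, M i j • (X j : MvPolynomial (Fin l) ℂ)) (by
    intro i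
    apply IsHomogeneous.sum
    intro j _
    rw [MvPolynomial.smul_eq_C_mul]
    exact isHomogeneous_C_mul_X _ _)
  rw [one_mul] at this
  exact this

lemma sb_homComp {l : ℕ} (M : Matrix (Fin l) (Fin l) ℂ) (f : MvPolynomial (Fin l) ℂ) (k : ℕ) :
    sb M (homogeneousComponent k f) = homogeneousComponent k (sb M f) := by
  conv_rhs => rw [← sum_homogeneousComponent f, map_sum, map_sum]
  have : ∀ i, homogeneousComponent k (sb M (homogeneousComponent i f))
      = if k = i then sb M (homogeneousComponent i f) else 0 := fun i =>
    homogeneousComponent_of_mem (sb_hom M (homogeneousComponent_isHomogeneous i f))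
  simp only [this, Finset.sum_ite_eq, Finset.mem_range]
  split_ifs with h
  · rfl
  · rw [homogeneousComponent_eq_zero _ _ (by lia), map_zero]

/-- chain rule -/
lemma pderiv_aeval {l : ℕ} (h : Fin l → MvPolynomial (Fin l) ℂ) (f : MvPolynomial (Fin l) ℂ)
    (j : Fin l) : pderiv j (aeval h f) = ∑ i, aeval h (pderiv i f) * pderiv j (h i) := by
  induction f using MvPolynomial.induction_on with
  | C a => simp
  | add p q hp hq => simp only [map_add, hp, hq, add_mul, Finset.sum_add_distrib]
  | mul_X p n hp =>
    simp only [map_mul, Derivation.leibniz, aeval_X, smul_eq_mul, hp, pderiv_X, map_add, add_mul,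
      Finset.sum_add_distrib, Finset.mul_sum]
    congr 1
    · rw [Finset.sum_eq_single n]
      · simp
      · intro b _ hb; simp [hb]
      · simp
    · apply Finset.sum_congr rfl; intros; ring

/-- the Jacobian determinant -/
noncomputable def jac {l : ℕ} (g : Fin l → MvPolynomial (Fin l) ℂ) : MvPolynomial (Fin l) ℂ :=
  (Matrix.of fun i j => pderiv j (g i)).det

lemma jac_semi {l : ℕ} (M : Matrix (Fin l) (Fin l) ℂ) (g : Fin l → MvPolynomial (Fin l) ℂ)
    (h : ∀ i, sb M (g i) = g i) : C M.det * sb M (jac g) = jac g := by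
  have h1 : (Matrix.of fun i j => pderiv j (g i))
      = ((sb M).mapMatrix (Matrix.of fun i j => pderiv j (g i))) * (M.map C) := by
    ext1 i j
    simp only [Matrix.of_apply, Matrix.mul_apply, AlgHom.mapMatrix_apply, Matrix.map_apply]
    conv_lhs => rw [← h i, sb, pderiv_aeval]
    apply Finset.sum_congr rfl
    intro k _
    congr 1
    simp [Pi.single_apply, MvPolynomial.smul_eq_C_mul]
  unfold jac
  conv_rhs => rw [h1, Matrix.det_mul]
  rw [← AlgHom.map_det, mul_comm]
  congr 1
  exact (RingHom.map_det C M)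

lemma jac_hom {l : ℕ} (g : Fin l → MvPolynomial (Fin l) ℂ) (d : Fin l → ℕ)
    (hhom : ∀ i, (g i).IsHomogeneous (d i)) : (jac g).IsHomogeneous (∑ i, (d i - 1)) := by
  unfold jac
  rw [← Matrix.det_transpose, Matrix.det_apply]
  apply IsHomogeneous.sum
  intro σ _
  rw [← mem_homogeneousSubmodule]
  apply Submodule.smul_of_tower_mem
  rw [mem_homogeneousSubmodule]
  apply IsHomogeneous.prod
  intro i _
  exact (hhom i).pderiv

lemma pderiv_all_zero {l : ℕ} (p : MvPolynomial (Fin l) ℂ) (h : ∀ i, pderiv i p = 0) :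
    p = C (coeff 0 p) := by
  ext m
  rw [coeff_C]
  split_ifs with hm
  · rw [hm]
  · obtain ⟨i, hi⟩ : ∃ i, m i ≠ 0 := by
      by_contra hc
      push Not at hc
      exact hm (by ext i; simp [hc i])
    have := coeff_pderiv (i := i) p (m - Finsupp.single i 1)
    rw [h i, coeff_zero, tsub_add_cancel_of_le (by
      rw [Finsupp.single_le_iff]; lia)] at this
    rcases mul_eq_zero.1 this.symm with h3 | h3
    · exact h3
    · exact absurd h3 (Nat.cast_add_one_ne_zero _)

lemma alg_indep {l : ℕ} (g : Fin l → MvPolynomial (Fin l) ℂ) (hj : jac g ≠ 0) :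
    ∀ n (p : MvPolynomial (Fin l) ℂ), p.totalDegree ≤ n → aeval g p = 0 → p = 0 := by
  intro n
  have key : ∀ p : MvPolynomial (Fin l) ℂ, aeval g p = 0 → ∀ i, aeval g (pderiv i p) = 0 := by
    intro p hp
    have h := Matrix.eq_zero_of_vecMul_eq_zero (M := Matrix.of fun i j => pderiv j (g i)) hj
      (v := fun i => aeval g (pderiv i p)) (by
        ext1 j
        have := pderiv_aeval g p j
        rw [hp, map_zero] at this
        simp only [Matrix.vecMul, dotProduct, Matrix.of_apply, Pi.zero_apply]
        exact this.symm)
    exact fun i => congrFun h i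
  have fin : ∀ p : MvPolynomial (Fin l) ℂ, aeval g p = 0 → (∀ i, pderiv i p = 0) → p = 0 := by
    intro p hp h
    have := pderiv_all_zero p h
    rw [this] at hp ⊢
    simpa using hp
  induction n with
  | zero =>
    intro p hn hp
    refine fin p hp fun i => ?_
    rw [totalDegree_eq_zero_iff_eq_C.1 (by lia : p.totalDegree = 0), pderiv_C]
  | succ n ih =>
    intro p hn hp
    refine fin p hp fun i => ih _ ?_ (key p hp i)
    apply Finset.sup_le
    intro m hm
    have h1 : m + Finsupp.single i 1 ∈ p.support := by
      rw [MvPolynomial.mem_support_iff] at hm ⊢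
      intro h0
      rw [coeff_pderiv, h0, zero_mul] at hm
      exact hm rfl
    have h2 := (le_totalDegree h1).trans hn
    rw [Finsupp.sum_add_index' (fun _ => rfl) (fun _ _ _ => rfl),
      Finsupp.sum_single_index rfl] at h2
    lia

end Springer
namespace Springer

lemma exists_form {l : ℕ} (H : Submodule ℂ (Fin l → ℂ)) (hH : finrank ℂ H = l - 1) (hne : H ≠ ⊤) :
    ∃ φ v : Fin l → ℂ, φ ⬝ᵥ v = 1 ∧ ∀ x, x ∈ H ↔ φ ⬝ᵥ x = 0 := by
  have hl : 1 ≤ l := by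
    by_contra h
    obtain rfl : l = 0 := by lia
    exact hne (Subsingleton.elim _ _)
  have h1 : finrank ℂ ((Fin l → ℂ) ⧸ H) = 1 := by
    have := H.finrank_quotient_add_finrank
    rw [hH, finrank_fin_fun] at this
    lia
  let e : ((Fin l → ℂ) ⧸ H) ≃ₗ[ℂ] ℂ := LinearEquiv.ofFinrankEq _ _ (by rw [h1, finrank_self])
  let f : (Fin l → ℂ) →ₗ[ℂ] ℂ := e.toLinearMap ∘ₗ H.mkQ
  have hf : ∀ x, f x = (fun i => f (Pi.single i 1)) ⬝ᵥ x := by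
    intro x
    rw [LinearMap.pi_apply_eq_sum_univ f x]
    simp only [dotProduct, smul_eq_mul]
    apply Finset.sum_congr rfl
    intro i _
    rw [mul_comm]
    congr 2
    ext j
    simp [Pi.single_apply, eq_comm]
  obtain ⟨v, hv⟩ := H.mkQ_surjective (e.symm 1)
  refine ⟨fun i => f (Pi.single i 1), v, ?_, ?_⟩
  · rw [← hf]; simp [f, hv]
  · intro x
    rw [← hf]
    simp [f]

lemma rank_one {l : ℕ} {φ v : Fin l → ℂ} (hv : φ ⬝ᵥ v = 1) (N : Matrix (Fin l) (Fin l) ℂ)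
    (hN : ∀ x, φ ⬝ᵥ x = 0 → N.mulVec x = 0) : N = Matrix.vecMulVec (N.mulVec v) φ := by
  apply Matrix.toLin'.injective
  ext1 i
  ext1
  simp only [LinearMap.comp_apply, Matrix.toLin'_apply, LinearMap.single_apply]
  generalize (Pi.single i 1 : Fin l → ℂ) = x
  have := hN (x - (φ ⬝ᵥ x) • v) (by simp [dotProduct_sub, hv])
  rw [Matrix.mulVec_sub, Matrix.mulVec_smul, sub_eq_zero] at this
  rw [this, Matrix.vecMulVec_mulVec]
  ext j; simp [mul_comm]

/-- linear form -/
noncomputable def lin {l : ℕ} (φ : Fin l → ℂ) : MvPolynomial (Fin l) ℂ := ∑ j, φ j • X j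

lemma eval_lin {l : ℕ} (φ x : Fin l → ℂ) : eval x (lin φ) = φ ⬝ᵥ x := by
  simp [lin, dotProduct, smul_eval]

lemma lin_hom {l : ℕ} (φ : Fin l → ℂ) : (lin φ).IsHomogeneous 1 := by
  apply IsHomogeneous.sum
  intro j _
  rw [MvPolynomial.smul_eq_C_mul]
  exact isHomogeneous_C_mul_X _ _

lemma lin_ne {l : ℕ} {φ v : Fin l → ℂ} (hv : φ ⬝ᵥ v = 1) : lin φ ≠ 0 := by
  intro h
  have := eval_lin φ v
  rw [h, hv] at this
  simp at this

lemma lin_irr {l : ℕ} {φ v : Fin l → ℂ} (hv : φ ⬝ᵥ v = 1) : Irreducible (lin φ) := by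
  apply irreducible_of_totalDegree_eq_one ((lin_hom φ).totalDegree (lin_ne hv))
  intro x hx
  rw [isUnit_iff_ne_zero]
  rintro rfl
  apply lin_ne hv
  ext m
  simpa using hx m

lemma sb_lin {l : ℕ} (a φ : Fin l → ℂ) :
    sb (1 + Matrix.vecMulVec a φ) (lin φ) = C (1 + φ ⬝ᵥ a) * lin φ := by
  have : ∀ i, sb (1 + Matrix.vecMulVec a φ) (X i) = X i + C (a i) * lin φ := by
    intro i
    simp [sb_X, Matrix.one_apply, add_smul, Finset.sum_add_distrib, Matrix.vecMulVec_apply, lin,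
      Finset.mul_sum, MvPolynomial.smul_eq_C_mul, mul_assoc]
  conv_lhs => rw [lin]
  simp only [map_sum, map_smul, this, smul_add, Finset.sum_add_distrib]
  rw [map_add, add_mul, map_one, one_mul]
  congr 1
  simp [dotProduct, Finset.sum_mul, MvPolynomial.smul_eq_C_mul, mul_assoc]

lemma sb_sub_dvd {l : ℕ} (a φ : Fin l → ℂ) (u : MvPolynomial (Fin l) ℂ) :
    lin φ ∣ sb (1 + Matrix.vecMulVec a φ) u - u := by
  rw [← Ideal.mem_span_singleton, ← Ideal.Quotient.eq]
  have : (Ideal.Quotient.mkₐ ℂ (Ideal.span {lin φ})).comp (sb (1 + Matrix.vecMulVec a φ))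
      = Ideal.Quotient.mkₐ ℂ (Ideal.span {lin φ}) := by
    apply MvPolynomial.algHom_ext
    intro i
    simp only [AlgHom.comp_apply, Ideal.Quotient.mkₐ_eq_mk]
    rw [Ideal.Quotient.eq, Ideal.mem_span_singleton]
    refine ⟨C (a i), ?_⟩
    simp [sb_X, Matrix.one_apply, add_smul, Finset.sum_add_distrib, Matrix.vecMulVec_apply, lin,
      Finset.sum_mul, MvPolynomial.smul_eq_C_mul]
    apply Finset.sum_congr rfl; intros; ring
  exact DFunLike.congr_fun this u

lemma det_one_add {l : ℕ} (a φ : Fin l → ℂ) :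
    (1 + Matrix.vecMulVec a φ).det = 1 + φ ⬝ᵥ a := by
  rw [Matrix.vecMulVec_eq Unit, Matrix.det_one_add_replicateCol_mul_replicateRow]

lemma one_add_pow {l : ℕ} (c φ : Fin l → ℂ) (h : φ ⬝ᵥ c = 0) (k : ℕ) :
    (1 + Matrix.vecMulVec c φ) ^ k = 1 + (k : ℂ) • Matrix.vecMulVec c φ := by
  induction k with
  | zero => simp
  | succ k ih =>
    rw [pow_succ, ih, mul_add, mul_one, add_mul, one_mul, Matrix.smul_mul,
      Matrix.vecMulVec_mul_vecMulVec, h]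
    simp [add_smul]
    abel

lemma det_inj {l : ℕ} (C : Subgroup (Matrix.GeneralLinearGroup (Fin l) ℂ)) [Finite C]
    (φ : Fin l → ℂ) (M M' : Matrix.GeneralLinearGroup (Fin l) ℂ) (hM : M ∈ C) (hM' : M' ∈ C)
    (a a' : Fin l → ℂ) (h : (M : Matrix (Fin l) (Fin l) ℂ) = 1 + Matrix.vecMulVec a φ)
    (h' : (M' : Matrix (Fin l) (Fin l) ℂ) = 1 + Matrix.vecMulVec a' φ)
    (hd : (M : Matrix (Fin l) (Fin l) ℂ).det = (M' : Matrix (Fin l) (Fin l) ℂ).det) : M = M' := by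
  let c := ((M'⁻¹ : Matrix.GeneralLinearGroup (Fin l) ℂ) : Matrix (Fin l) (Fin l) ℂ).mulVec (a - a')
  have hmul : ((M'⁻¹ : Matrix.GeneralLinearGroup (Fin l) ℂ) : Matrix (Fin l) (Fin l) ℂ) * 
      (M' : Matrix (Fin l) (Fin l) ℂ) = 1 := by
    rw [← Units.val_mul, inv_mul_cancel, Units.val_one]
  have h1 : ((M'⁻¹ * M : Matrix.GeneralLinearGroup (Fin l) ℂ) : Matrix (Fin l) (Fin l) ℂ)
      = 1 + Matrix.vecMulVec c φ := by
    have h2 : (M : Matrix (Fin l) (Fin l) ℂ) = M' + Matrix.vecMulVec (a - a') φ := by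
      rw [h, h', Matrix.sub_vecMulVec]; abel
    rw [Units.val_mul, h2, mul_add, hmul, Matrix.mul_vecMulVec]
  have h3 : φ ⬝ᵥ c = 0 := by
    have h4 := det_one_add c φ
    rw [← h1, Units.val_mul, Matrix.det_mul, hd, ← Matrix.det_mul, hmul, Matrix.det_one] at h4
    simpa using h4
  have hfin : IsOfFinOrder (⟨M'⁻¹ * M, C.mul_mem (C.inv_mem hM') hM⟩ : C) := isOfFinOrder_of_finite _
  obtain ⟨k, hk, hk1⟩ := isOfFinOrder_iff_pow_eq_one.1 hfin
  have hk2 : (M'⁻¹ * M) ^ k = 1 := by simpa using congrArg Subtype.val hk1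
  have hk3 := congrArg (fun A : Matrix.GeneralLinearGroup (Fin l) ℂ => (A : Matrix (Fin l) (Fin l) ℂ)) hk2
  simp only [Units.val_pow_eq_pow_val, h1, Units.val_one] at hk3
  rw [one_add_pow c φ h3, add_eq_left, smul_eq_zero] at hk3
  have hk4 : Matrix.vecMulVec c φ = 0 := hk3.resolve_left (by exact_mod_cast hk.ne')
  have : M'⁻¹ * M = 1 := by
    apply Units.ext
    rw [h1, hk4, add_zero, Units.val_one]
  exact (inv_mul_eq_one.1 this).symm

lemma pow_dvd {l : ℕ} (G : Subgroup (Matrix.GeneralLinearGroup (Fin l) ℂ)) [Finite G]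
    {φ v : Fin l → ℂ} (hv : φ ⬝ᵥ v = 1) (T : Finset (Matrix.GeneralLinearGroup (Fin l) ℂ))
    (hT : ∀ M ∈ T, M ∈ G)
    (ha : ∀ M ∈ T, ∃ a, (M : Matrix (Fin l) (Fin l) ℂ) = 1 + Matrix.vecMulVec a φ)
    (h : MvPolynomial (Fin l) ℂ) 
    (hh : ∀ M ∈ G, C (M : Matrix (Fin l) (Fin l) ℂ).det * sb (M : Matrix (Fin l) (Fin l) ℂ) h = h) :
    lin φ ^ (T.card - 1) ∣ h := by
  by_cases h0 : h = 0
  · rw [h0]; exact dvd_zero _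
  obtain ⟨u, hu, hnd⟩ := (FiniteMultiplicity.of_not_isUnit (lin_irr hv).not_isUnit
    h0).exists_eq_pow_mul_and_not_dvd
  set n := multiplicity (lin φ) h
  refine dvd_trans (pow_dvd_pow _ ?_) (Dvd.intro _ hu.symm)
  have hroot : ∀ M ∈ T, (M : Matrix (Fin l) (Fin l) ℂ).det ^ (n + 1) = 1 := by
    intro M hM
    obtain ⟨a, ha⟩ := ha M hM
    have h1 := hh M (hT M hM)
    have hd : (M : Matrix (Fin l) (Fin l) ℂ).det = 1 + φ ⬝ᵥ a := by rw [ha, det_one_add]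
    have hs : sb (M : Matrix (Fin l) (Fin l) ℂ) (lin φ) =
        C (M : Matrix (Fin l) (Fin l) ℂ).det * lin φ := by rw [hd, ha, sb_lin]
    generalize (M : Matrix (Fin l) (Fin l) ℂ).det = δ at *
    rw [hu, map_mul, map_pow, hs] at h1
    have h2 : C (δ ^ (n + 1)) * sb (M : Matrix (Fin l) (Fin l) ℂ) u = u := by
      apply mul_left_cancel₀ (pow_ne_zero n (lin_ne hv))
      refine Eq.trans ?_ h1
      rw [map_pow, mul_pow]
      ring
    have h3 : lin φ ∣ C (δ ^ (n + 1) - 1) * u := by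
      have h4 : C (δ ^ (n + 1) - 1) * u =
          - (C (δ ^ (n + 1)) * (sb (M : Matrix (Fin l) (Fin l) ℂ) u - u)) := by
        rw [mul_sub, h2, map_sub, map_one]; ring
      rw [h4, ha]
      exact (dvd_neg.2 ((sb_sub_dvd a φ u).mul_left _))
    by_contra hne
    apply hnd
    have hunit : IsUnit (C (δ ^ (n + 1) - 1) : MvPolynomial (Fin l) ℂ) :=
      (isUnit_iff_ne_zero.2 (sub_ne_zero.2 hne)).map C
    exact (hunit.dvd_mul_left).1 h3
  have hcard : T.card ≤ n + 1 := by
    classical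
    calc T.card = (T.image fun M : Matrix.GeneralLinearGroup (Fin l) ℂ => (M : Matrix (Fin l) (Fin l) ℂ).det).card := by
          rw [Finset.card_image_of_injOn]
          intro M hM M' hM' hd
          obtain ⟨a, ha1⟩ := ha M hM
          obtain ⟨a', ha2⟩ := ha M' hM'
          exact det_inj G φ M M' (hT M hM) (hT M' hM') a a' ha1 ha2 hd
      _ ≤ (Polynomial.nthRoots (n + 1) (1 : ℂ)).toFinset.card := by
          apply Finset.card_le_card
          intro x hx
          obtain ⟨M, hM, rfl⟩ := Finset.mem_image.1 hx
          rw [Multiset.mem_toFinset, Polynomial.mem_nthRoots (by lia)]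
          exact hroot M hM
      _ ≤ _ := (Multiset.toFinset_card_le _).trans (Polynomial.card_nthRoots _ _)
  lia

/-- reflections in `G` -/
def refl {l : ℕ} (G : Subgroup (Matrix.GeneralLinearGroup (Fin l) ℂ)) :
    Set (Matrix.GeneralLinearGroup (Fin l) ℂ) :=
  {M | M ∈ G ∧ M ≠ 1 ∧ finrank ℂ (LinearMap.ker (Matrix.toLin'
            ((M : Matrix (Fin l) (Fin l) ℂ) - 1))) = l - 1}

lemma exists_delta {l : ℕ} (G : Subgroup (Matrix.GeneralLinearGroup (Fin l) ℂ)) [Finite G]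
    (R : Finset (Matrix.GeneralLinearGroup (Fin l) ℂ)) (hR : ∀ M, M ∈ R ↔ M ∈ refl G) :
    ∃ Δ : MvPolynomial (Fin l) ℂ, Δ ≠ 0 ∧ Δ.totalDegree = R.card ∧
      ∀ h, (∀ M ∈ G, C (M : Matrix (Fin l) (Fin l) ℂ).det *
        sb (M : Matrix (Fin l) (Fin l) ℂ) h = h) → Δ ∣ h := by
  classical
  let K : Matrix.GeneralLinearGroup (Fin l) ℂ → Submodule ℂ (Fin l → ℂ) := fun M =>
    LinearMap.ker (Matrix.toLin' ((M : Matrix (Fin l) (Fin l) ℂ) - 1))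
  have hK : ∀ H ∈ R.image K, finrank ℂ H = l - 1 ∧ H ≠ ⊤ := by
    intro H hH
    obtain ⟨M, hM, rfl⟩ := Finset.mem_image.1 hH
    have hM := (hR M).1 hM
    refine ⟨hM.2.2, fun ht => hM.2.1 ?_⟩
    have := LinearMap.ker_eq_top.1 ht
    rw [LinearEquiv.map_eq_zero_iff, sub_eq_zero] at this
    exact Units.ext this
  have hform : ∀ H : Submodule ℂ (Fin l → ℂ), ∃ φ v : Fin l → ℂ, H ∈ R.image K →
      φ ⬝ᵥ v = 1 ∧ ∀ x, x ∈ H ↔ φ ⬝ᵥ x = 0 := by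
    intro H
    by_cases hH : H ∈ R.image K
    · obtain ⟨φ, v, h⟩ := exists_form H (hK H hH).1 (hK H hH).2
      exact ⟨φ, v, fun _ => h⟩
    · exact ⟨0, 0, fun h => absurd h hH⟩
  choose φ v hφ using hform
  let e : Submodule ℂ (Fin l → ℂ) → ℕ := fun H => (R.filter (fun M => K M = H)).card
  have hne : ∀ H ∈ R.image K, lin (φ H) ^ e H ≠ 0 := fun H hH => 
    pow_ne_zero _ (lin_ne (hφ H hH).1)
  have hne2 : ∏ H ∈ R.image K, lin (φ H) ^ e H ≠ 0 := Finset.prod_ne_zero_iff.2 hne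
  refine ⟨∏ H ∈ R.image K, lin (φ H) ^ e H, hne2, ?_, ?_⟩
  · rw [IsHomogeneous.totalDegree (n := ∑ H ∈ R.image K, e H) _ hne2]
    · exact (Finset.card_eq_sum_card_image K R).symm
    · apply IsHomogeneous.prod
      intro H _
      simpa using (lin_hom (φ H)).pow (e H)
  · intro h hh
    apply Finset.prod_dvd_of_isRelPrime
    · intro H hH H' hH' hHH
      apply IsRelPrime.pow
      rw [(lin_irr (hφ H hH).1).isRelPrime_iff_not_dvd]
      rintro ⟨w, hw⟩
      apply hHH
      apply Submodule.eq_of_le_of_finrank_eq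
      · intro x hx
        rw [(hφ H hH).2] at hx
        rw [(hφ H' hH').2, ← eval_lin, hw, map_mul, eval_lin, hx, zero_mul]
      · rw [(hK H hH).1, (hK H' hH').1]
    · intro H hH
      have h1 : (1 : Matrix.GeneralLinearGroup (Fin l) ℂ) ∉ R.filter (fun M => K M = H) := by
        intro h1
        exact ((hR _).1 (Finset.mem_filter.1 h1).1).2.1 rfl
      have := pow_dvd G (hφ H hH).1 (insert 1 (R.filter (fun M => K M = H))) ?_ ?_ h hh
      · rwa [Finset.card_insert_of_notMem h1, Nat.add_sub_cancel] at this
      · intro M hM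
        rcases Finset.mem_insert.1 hM with rfl | hM
        · exact G.one_mem
        · exact ((hR _).1 (Finset.mem_filter.1 hM).1).1
      · intro M hM
        rcases Finset.mem_insert.1 hM with rfl | hM
        · exact ⟨0, by simp⟩
        · have hM := (Finset.mem_filter.1 hM).2
          refine ⟨_, eq_add_of_sub_eq' (rank_one (hφ H hH).1 _ ?_)⟩
          intro x hx
          rw [← (hφ H hH).2, ← hM] at hx
          exact hx

end Springer
namespace Springer

lemma homComp_mul {l : ℕ} (c g : MvPolynomial (Fin l) ℂ) (d k : ℕ) (hg : g.IsHomogeneous d)  :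
    homogeneousComponent k (c * g) =
      if d ≤ k then homogeneousComponent (k - d) c * g else 0 := by
  conv_lhs => rw [← sum_homogeneousComponent c, Finset.sum_mul, map_sum]
  have : ∀ i, homogeneousComponent k (homogeneousComponent i c * g)
      = if k = i + d then homogeneousComponent i c * g else 0 := fun i =>
    homogeneousComponent_of_mem ((homogeneousComponent_isHomogeneous i c).mul hg)
  simp only [this]
  split_ifs with h
  · rw [Finset.sum_eq_single (k - d)]
    · rw [if_pos (by lia)]
    · intro b _ hb
      rw [if_neg (by lia)]
    · intro hb
      rw [homogeneousComponent_eq_zero _ _ (by simp only [Finset.mem_range, not_lt] at hb; lia)]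
      simp
  · apply Finset.sum_eq_zero
    intro i _
    rw [if_neg (by lia)]

lemma final {l : ℕ} (G : Subgroup (Matrix.GeneralLinearGroup (Fin l) ℂ)) [Finite G]
    (R : Finset (Matrix.GeneralLinearGroup (Fin l) ℂ)) (hR : ∀ M, M ∈ R ↔ M ∈ refl G)
    (g : Fin l → MvPolynomial (Fin l) ℂ) (d : Fin l → ℕ)
    (hhom : ∀ i, (g i).IsHomogeneous (d i)) (hjac : jac g ≠ 0)
    (hinv : ∀ M ∈ G, ∀ i, sb (M : Matrix (Fin l) (Fin l) ℂ) (g i) = g i)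
    (hd : ∀ i, 0 < d i) (hle : ∑ i, (d i - 1) ≤ R.card) (f : MvPolynomial (Fin l) ℂ)
    (hf : ∀ M ∈ G, sb (M : Matrix (Fin l) (Fin l) ℂ) f = f) :
    f ∈ Algebra.adjoin ℂ (Set.range g) := by
  obtain ⟨Δ, hΔ0, hΔd, hΔ⟩ := exists_delta G R hR
  have hJdvd : ∀ h, (∀ M ∈ G, C (M : Matrix (Fin l) (Fin l) ℂ).det *
        sb (M : Matrix (Fin l) (Fin l) ℂ) h = h) → jac g ∣ h := by
    intro h hh
    obtain ⟨u, hu⟩ := hΔ (jac g) (fun M hM => jac_semi _ _ (hinv M hM))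
    have hu0 : u ≠ 0 := by rintro rfl; exact hjac (by simpa using hu)
    have hdeg : (jac g).totalDegree = R.card + u.totalDegree := by
      rw [hu, totalDegree_mul_of_isDomain hΔ0 hu0, hΔd]
    rw [(jac_hom g d hhom).totalDegree hjac] at hdeg
    have hu1 := totalDegree_eq_zero_iff_eq_C.1 (by lia : u.totalDegree = 0)
    have hunit : IsUnit u := by
      rw [hu1]
      apply IsUnit.map
      rw [isUnit_iff_ne_zero]
      intro h0
      rw [h0, map_zero] at hu1
      exact hu0 hu1
    rw [hu]
    exact (hunit.mul_right_dvd).2 (hΔ h hh)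
  have main : ∀ k, ∀ f : MvPolynomial (Fin l) ℂ, f.IsHomogeneous k →
      (∀ M ∈ G, sb (M : Matrix (Fin l) (Fin l) ℂ) f = f) → f ∈ Algebra.adjoin ℂ (Set.range g) := by
    intro k
    induction k using Nat.strong_induction_on with
    | _ k ih =>
    intro f hfk hf
    rcases Nat.eq_zero_or_pos k with rfl | hk
    · rw [totalDegree_eq_zero_iff_eq_C.1 ((totalDegree_zero_iff_isHomogeneous _).2 hfk)]
      exact Subalgebra.algebraMap_mem _ _
    have hupd : ∀ i, jac g ∣ jac (Function.update g i f) := by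
      intro i
      apply hJdvd
      intro M hM
      apply jac_semi
      intro j
      by_cases hj : j = i
      · subst hj; simp [hf M hM]
      · simp [hj, hinv M hM]
    choose c hc using hupd
    have hcinv : ∀ i, ∀ M ∈ G, sb (M : Matrix (Fin l) (Fin l) ℂ) (c i) = c i := by
      intro i M hM
      have h1 : C (M : Matrix (Fin l) (Fin l) ℂ).det * sb (M : Matrix (Fin l) (Fin l) ℂ)
          (jac (Function.update g i f)) = jac (Function.update g i f) := by
        apply jac_semi
        intro j
        by_cases hj : j = i
        · subst hj; simp [hf M hM]
        · simp [hj, hinv M hM]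
      have h2 := jac_semi _ _ (hinv M hM)
      rw [hc i, map_mul, ← mul_assoc, h2] at h1
      exact mul_left_cancel₀ hjac h1
    have hpd : ∀ j, pderiv j f = ∑ i, c i * pderiv j (g i) := by
      intro j
      apply mul_left_cancel₀ hjac
      let A : Matrix (Fin l) (Fin l) (MvPolynomial (Fin l) ℂ) := Matrix.of fun i j => pderiv j (g i)
      have h1 := congrFun (Matrix.mulVec_cramer A.transpose (fun j => pderiv j f)) j
      simp only [Matrix.mulVec, dotProduct, Matrix.transpose_apply, Matrix.det_transpose,
        Pi.smul_apply, smul_eq_mul] at h1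
      have h2 : ∀ i, Matrix.cramer A.transpose (fun j => pderiv j f) i = jac g * c i := by
        intro i
        rw [← hc i, Matrix.cramer_transpose_apply, jac]
        congr 1
        ext1 a b
        by_cases hab : a = i
        · subst hab; simp
        · simp [hab, A]
      rw [jac, ← h1, Finset.mul_sum]
      apply Finset.sum_congr rfl
      intro i _
      rw [h2, jac]
      simp only [A, Matrix.of_apply]
      ring
    have heuler : (k : ℕ) • f = ∑ i, (d i) • (c i * g i) := by
      rw [← hfk.sum_X_mul_pderiv]
      simp only [hpd, Finset.mul_sum]
      rw [Finset.sum_comm]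
      apply Finset.sum_congr rfl
      intro i _
      rw [← mul_smul_comm, ← (hhom i).sum_X_mul_pderiv, Finset.mul_sum]
      apply Finset.sum_congr rfl
      intros; ring
    have h3 := congrArg (homogeneousComponent k) heuler
    rw [map_nsmul, homogeneousComponent_eq_self hfk, map_sum] at h3
    have h4 : (k : ℕ) • f ∈ Algebra.adjoin ℂ (Set.range g) := by
      rw [h3]
      apply Subalgebra.sum_mem
      intro i _
      rw [map_nsmul, homComp_mul _ _ _ _ (hhom i)]
      apply nsmul_mem
      split_ifs with h
      · apply Subalgebra.mul_mem
        · apply ih (k - d i) (by have := hd i; lia) _ (homogeneousComponent_isHomogeneous _ _)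
          intro M hM
          rw [sb_homComp, hcinv i M hM]
        · exact Algebra.subset_adjoin ⟨i, rfl⟩
      · exact Subalgebra.zero_mem _
    have h5 : f = (k : ℂ)⁻¹ • ((k : ℕ) • f) := by
      rw [← Nat.cast_smul_eq_nsmul ℂ, smul_smul, inv_mul_cancel₀ (by exact_mod_cast hk.ne'), one_smul]
    rw [h5]
    exact Subalgebra.smul_mem _ h4 _
  rw [← sum_homogeneousComponent f]
  apply Subalgebra.sum_mem
  intro i _
  apply main i _ (homogeneousComponent_isHomogeneous _ _)
  intro M hM
  rw [sb_homComp, hf M hM]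

end Springer
namespace Springer
open Filter Topology

lemma hasSum_geom : ∀ {l : ℕ} (z : Fin l → ℂ), (∀ i, ‖z i‖ < 1) →
    (Summable fun α : Fin l → ℕ => ‖∏ i, z i ^ α i‖) ∧
      HasSum (fun α : Fin l → ℕ => ∏ i, z i ^ α i) (∏ i, (1 - z i)⁻¹) := by
  intro l
  induction l with
  | zero =>
    intro z _
    refine ⟨(hasSum_fintype _).summable, ?_⟩
    simp
  | succ n ih =>
    intro z hz
    obtain ⟨h1, h2⟩ := ih (fun i => z i.succ) (fun i => hz _)
    have h3 := hasSum_geometric_of_norm_lt_one (hz 0)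
    have h4 : Summable fun n : ℕ => ‖z 0 ^ n‖ := by
      simpa using summable_geometric_of_lt_one (norm_nonneg _) (hz 0)
    have h5 := Summable.mul_norm h4 h1
    have h6 := h3.mul h2 h5.of_norm
    let e : ℕ × (Fin n → ℕ) ≃ (Fin (n + 1) → ℕ) := Fin.consEquiv (fun _ => ℕ)
    have h7 : ∀ p : ℕ × (Fin n → ℕ), ∏ i, z i ^ (e p i) = z 0 ^ p.1 * ∏ i, z (Fin.succ i) ^ p.2 i := by
      intro p
      rw [Fin.prod_univ_succ]
      simp [e, Fin.consEquiv]
    constructor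
    · rw [← e.summable_iff]
      refine h5.congr fun p => ?_
      simp only [Function.comp_apply, h7]
    · rw [← e.hasSum_iff, Fin.prod_univ_succ]
      have h8 : ((fun α : Fin (n + 1) → ℕ => ∏ i, z i ^ α i) ∘ e) =
          fun p => z 0 ^ p.1 * ∏ i, z (Fin.succ i) ^ p.2 i := funext h7
      rw [h8]
      exact h6

/-- exponents of weighted degree `k` -/
def Fz {l : ℕ} (w : Fin l → ℕ) (k : ℕ) : Finset (Fin l → ℕ) :=
  (Finset.Iic (fun _ => k)).filter (fun α => ∑ i, w i * α i = k)

lemma mem_Fz {l : ℕ} {w : Fin l → ℕ} (hw : ∀ i, 0 < w i) {k : ℕ} {α : Fin l → ℕ} :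
    α ∈ Fz w k ↔ ∑ i, w i * α i = k := by
  simp only [Fz, Finset.mem_filter, Finset.mem_Iic, and_iff_right_iff_imp]
  intro h i
  calc α i ≤ w i * α i := Nat.le_mul_of_pos_left _ (hw i)
    _ ≤ ∑ i, w i * α i := Finset.single_le_sum (f := fun i => w i * α i) (fun _ _ => Nat.zero_le _)
      (Finset.mem_univ i)
    _ = k := h

lemma hasSum_graded {l : ℕ} (w : Fin l → ℕ) (hw : ∀ i, 0 < w i) (μ : Fin l → ℂ)
    (hμ : ∀ i, ‖μ i‖ = 1) (t : ℝ) (ht0 : 0 < t) (ht1 : t < 1) :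
    HasSum (fun k => (∑ α ∈ Fz w k, ∏ i, μ i ^ α i) * (t : ℂ) ^ k)
      (∏ i, (1 - μ i * (t : ℂ) ^ w i)⁻¹) := by
  obtain ⟨-, h⟩ := hasSum_geom (fun i => μ i * (t : ℂ) ^ w i) (by
    intro i
    rw [norm_mul, hμ, one_mul, norm_pow, Complex.norm_real, Real.norm_of_nonneg ht0.le]
    exact pow_lt_one₀ ht0.le ht1 (hw i).ne')
  rw [← (Equiv.sigmaFiberEquiv (fun α : Fin l → ℕ => ∑ i, w i * α i)).hasSum_iff] at h
  refine h.sigma ?_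
  intro k
  have h2 : ∀ x : {α : Fin l → ℕ // ∑ i, w i * α i = k},
      ∏ i, (μ i * (t : ℂ) ^ w i) ^ (x.1 i) = (∏ i, μ i ^ x.1 i) * (t : ℂ) ^ k := by
    intro x
    simp only [mul_pow, Finset.prod_mul_distrib, ← pow_mul, Finset.prod_pow_eq_pow_sum]
    rw [x.2]
  rw [Finset.sum_mul]
  have h3 := (Fz w k).hasSum (fun α => (∏ i, μ i ^ α i) * (t : ℂ) ^ k)
  let e : {α : Fin l → ℕ // ∑ i, w i * α i = k} ≃ ((Fz w k : Set (Fin l → ℕ)) : Type) :=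
    Equiv.subtypeEquivRight (fun α => (mem_Fz hw).symm)
  rw [← e.hasSum_iff] at h3
  convert h3 using 1
  funext x
  exact h2 x

lemma tendsto_term {l : ℕ} (μ : Fin l → ℂ) (hμ : ∀ i, ‖μ i‖ = 1)
    (hc : (Finset.univ.filter (fun i => μ i = 1)).card + 1 ≤ l) :
    Tendsto (fun t : ℝ => ((((1 - t : ℝ) : ℂ)) ^ (l - 1) * ∏ i, (1 - μ i * (t : ℂ))⁻¹).re) (𝓝[<] 1)
      (𝓝 (if (Finset.univ.filter (fun i => μ i = 1)).card = l - 1 then 1 / 2 else 0)) := by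
  set c := (Finset.univ.filter (fun i => μ i = 1)).card with hcdef
  have h1 : Tendsto (fun t : ℝ => ((((1 - t : ℝ) : ℂ)) ^ (l - 1 - c) *
      ∏ i ∈ Finset.univ.filter (fun i => ¬ μ i = 1), (1 - μ i * (t : ℂ))⁻¹)) (𝓝 1)
      (𝓝 ((((1 - 1 : ℝ) : ℂ)) ^ (l - 1 - c) *
      ∏ i ∈ Finset.univ.filter (fun i => ¬ μ i = 1), (1 - μ i * ((1 : ℝ) : ℂ))⁻¹)) := by
    apply Tendsto.mul
    · apply Continuous.tendsto (f := fun t : ℝ => (((1 - t : ℝ) : ℂ)) ^ (l - 1 - c))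
      fun_prop
    · apply tendsto_finsetProd
      intro i hi
      apply Tendsto.inv₀
      · apply Continuous.tendsto (f := fun t : ℝ => (1 - μ i * (t : ℂ)))
        fun_prop
      · rw [Complex.ofReal_one, mul_one, sub_ne_zero]
        exact fun h => (Finset.mem_filter.1 hi).2 h.symm
  have h2 := (Complex.continuous_re.tendsto _).comp 
    (h1.mono_left (nhdsWithin_le_nhds (s := Set.Iio (1 : ℝ))))
  have hlim : ((((1 - 1 : ℝ) : ℂ)) ^ (l - 1 - c) *
      ∏ i ∈ Finset.univ.filter (fun i => ¬ μ i = 1), (1 - μ i * ((1 : ℝ) : ℂ))⁻¹).re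
      = if c = l - 1 then 1 / 2 else 0 := by
    split_ifs with h
    · have hcard : (Finset.univ.filter (fun i => ¬ μ i = 1)).card = 1 := by
        have := Finset.card_filter_add_card_filter_not (s := (Finset.univ : Finset (Fin l)))
          (fun i => μ i = 1)
        rw [Finset.card_univ, Fintype.card_fin] at this
        lia
      obtain ⟨i, hi⟩ := Finset.card_eq_one.1 hcard
      have hi1 : μ i ≠ 1 := by
        have : i ∈ Finset.univ.filter (fun i => ¬ μ i = 1) := by rw [hi]; simp
        exact (Finset.mem_filter.1 this).2
      rw [hi, h]
      simp only [Nat.sub_self, pow_zero, one_mul, Finset.prod_singleton, Complex.ofReal_one, mul_one]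
      have hn := hμ i
      generalize μ i = ζ at *
      have h3 : ζ.re * ζ.re + ζ.im * ζ.im = 1 := by
        rw [← Complex.normSq_apply, Complex.normSq_eq_norm_sq, hn]; norm_num
      have h4 : ζ.re ≠ 1 := by
        intro h4
        apply hi1
        apply Complex.ext
        · simpa using h4
        · rw [h4] at h3
          have : ζ.im * ζ.im = 0 := by linarith
          simpa using this
      rw [Complex.inv_re, Complex.normSq_apply]
      simp only [Complex.sub_re, Complex.one_re, Complex.sub_im, Complex.one_im]
      have h5 : 1 - ζ.re ≠ 0 := sub_ne_zero.2 h4.symm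
      have h6 : (1 - ζ.re) * (1 - ζ.re) + (0 - ζ.im) * (0 - ζ.im) = 2 * (1 - ζ.re) := by
        linear_combination h3
      rw [h6]
      field_simp
    · have : l - 1 - c ≠ 0 := by lia
      simp [this]
  rw [hlim] at h2
  refine h2.congr' ?_
  filter_upwards [self_mem_nhdsWithin] with t ht
  have ht : (1 : ℂ) - t ≠ 0 := by
    rw [sub_ne_zero]
    exact_mod_cast (ne_of_lt ht).symm
  simp only [Function.comp_apply]
  congr 1
  rw [← Finset.prod_filter_mul_prod_filter_not Finset.univ (fun i => μ i = 1)
    (fun i => (1 - μ i * (t : ℂ))⁻¹), ← mul_assoc]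
  congr 1
  rw [Finset.prod_congr rfl (g := fun _ => (1 - (t : ℂ))⁻¹) (by
    intro i hi
    rw [(Finset.mem_filter.1 hi).2, one_mul]), Finset.prod_const, ← hcdef]
  have hlc : l - 1 = (l - 1 - c) + c := by lia
  conv_rhs => rw [hlc]
  push_cast
  rw [pow_add, mul_assoc, ← mul_pow, mul_inv_cancel₀ ht, one_pow, mul_one]

lemma tendsto_lhs {l : ℕ} (hl : 1 ≤ l) (d : Fin l → ℕ) (hd : ∀ i, 0 < d i) :
    Tendsto (fun t : ℝ => ((∏ i, d i : ℕ) * ∏ i, (1 - t ^ d i)⁻¹ - ∏ _i : Fin l, (1 - t)⁻¹)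
      * (1 - t) ^ (l - 1)) (𝓝[<] 1) (𝓝 (∑ i, ((d i : ℝ) - 1) / 2)) := by
  let ψ : Fin l → ℝ → ℝ := fun i t => ∑ k ∈ Finset.range (d i), t ^ k
  have hψ1 : ∀ i, ψ i 1 = d i := by intro i; simp [ψ]
  have hψ0 : ∀ i, ψ i 1 ≠ 0 := by intro i; rw [hψ1]; exact_mod_cast (hd i).ne'
  have hder : ∀ i t, HasDerivAt (ψ i) (∑ k ∈ Finset.range (d i), (k : ℝ) * t ^ (k - 1)) t := by
    intro i t
    apply HasDerivAt.fun_sum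
    intro k _
    exact hasDerivAt_pow k t
  have hlog : logDeriv (fun t => ∏ i, ψ i t) 1 = ∑ i, ((d i : ℝ) - 1) / 2 := by
    rw [logDeriv_prod]
    · apply Finset.sum_congr rfl
      intro i _
      rw [logDeriv_apply, (hder i 1).deriv, hψ1]
      have : (∑ k ∈ Finset.range (d i), (k : ℝ) * 1 ^ (k - 1)) = (d i : ℝ) * (d i - 1) / 2 := by
        simp only [one_pow, mul_one]
        induction d i with
        | zero => simp
        | succ n ih => rw [Finset.sum_range_succ, ih]; push_cast; ring
      rw [this]
      have := hψ0 i
      rw [hψ1] at this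
      field_simp
    · intro i _; exact hψ0 i
    · intro i _; exact (hder i 1).differentiableAt
  have hdiff : DifferentiableAt ℝ (fun t => ∏ i, ψ i t) 1 := by
    apply DifferentiableAt.fun_finsetProd
    intro i _; exact (hder i 1).differentiableAt
  have h1 := (hasDerivAt_iff_tendsto_slope.1 hdiff.hasDerivAt).mono_left
    (nhdsWithin_mono (1 : ℝ) (fun t (ht : t ∈ Set.Iio (1 : ℝ)) => (ne_of_lt ht)))
  have h2 : Tendsto (fun t => ∏ i, ψ i t) (𝓝[<] 1) (𝓝 (∏ i, ψ i 1)) :=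
    hdiff.continuousAt.tendsto.mono_left nhdsWithin_le_nhds
  have hψne : ∏ i, ψ i 1 ≠ 0 := Finset.prod_ne_zero_iff.2 fun i _ => hψ0 i
  have h3 := h1.div h2 hψne
  rw [logDeriv_apply] at hlog
  rw [hlog] at h3
  refine h3.congr' ?_
  have hev := h2.eventually_ne hψne
  filter_upwards [self_mem_nhdsWithin, hev] with t ht hne
  have ht : 1 - t ≠ 0 := sub_ne_zero.2 (ne_of_lt ht).symm
  have h4 : ∀ i, 1 - t ^ d i = (1 - t) * ψ i t := fun i => (mul_neg_geom_sum t (d i)).symm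
  have h5 : ((∏ i, d i : ℕ) : ℝ) = ∏ i, ψ i 1 := by push_cast; simp [hψ1]
  have h6 : (1 - t) ^ l = (1 - t) ^ (l - 1) * (1 - t) := by
    rw [← pow_succ]; congr 1; lia
  simp only [Pi.div_apply]
  rw [slope_def_field, h5]
  simp only [h4, mul_inv, Finset.prod_mul_distrib, Finset.prod_inv_distrib, Finset.prod_const,
    Finset.card_univ, Fintype.card_fin]
  rw [h6]
  generalize ∏ i, ψ i t = a at *
  generalize ∏ i, ψ i 1 = b at *
  have h7 : t - 1 ≠ 0 := by rw [← neg_sub]; exact neg_ne_zero.2 ht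
  field_simp
  ring

end Springer
namespace Springer

lemma exists_diag {l : ℕ} (M : Matrix (Fin l) (Fin l) ℂ) (k : ℕ) (hk : 0 < k) (hM : M ^ k = 1) :
    ∃ (P Q : Matrix (Fin l) (Fin l) ℂ) (μ : Fin l → ℂ), P * Q = 1 ∧ Q * P = 1 ∧
      M = P * Matrix.diagonal μ * Q ∧ ∀ i, ‖μ i‖ = 1 := by
  classical
  let f : Module.End ℂ (Fin l → ℂ) := Matrix.toLin' M
  have hfk : f ^ k = 1 := by
    rw [← Matrix.toLin'_pow, hM, Matrix.toLin'_one]; rfl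
  have hss : f.IsSemisimple := by
    apply Module.End.isSemisimple_of_squarefree_aeval_eq_zero (p := Polynomial.X ^ k - 1)
    · apply Polynomial.Separable.squarefree
      exact Polynomial.separable_X_pow_sub_C (1 : ℂ) (by exact_mod_cast hk.ne') one_ne_zero
    · simp [hfk]
  have htop : ⨆ a, f.eigenspace a = ⊤ := hss.iSup_eigenspace_eq_top
  have hint : DirectSum.IsInternal (fun a : ℂ => f.eigenspace a) := by
    rw [DirectSum.isInternal_submodule_iff_iSupIndep_and_iSup_eq_top]
    exact ⟨f.eigenspaces_iSupIndep, htop⟩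
  let b0 := hint.collectedBasis (fun a => Module.finBasis ℂ (f.eigenspace a))
  have : Fintype (Σ a, Fin (finrank ℂ (f.eigenspace a))) := FiniteDimensional.fintypeBasisIndex b0
  have hcard : Fintype.card (Σ a, Fin (finrank ℂ (f.eigenspace a))) = l := by
    rw [← finrank_eq_card_basis b0, finrank_fin_fun]
  let e := Fintype.equivFinOfCardEq hcard
  let b := b0.reindex e
  let μ : Fin l → ℂ := fun i => (e.symm i).1
  have hb : ∀ i, f (b i) = μ i • b i := by
    intro i
    rw [← Module.End.mem_eigenspace_iff]
    have := hint.collectedBasis_mem (fun a => Module.finBasis ℂ (f.eigenspace a)) (e.symm i)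
    simpa [b, b0] using this
  let s := Pi.basisFun ℂ (Fin l)
  refine ⟨s.toMatrix b, b.toMatrix s, μ, Basis.toMatrix_mul_toMatrix_flip _ _,
    Basis.toMatrix_mul_toMatrix_flip _ _, ?_, ?_⟩
  · have h1 : LinearMap.toMatrix b b f = Matrix.diagonal μ := by
      ext i j
      rw [LinearMap.toMatrix_apply, hb, map_smul, Basis.repr_self]
      by_cases h : i = j
      · subst h; simp
      · simp [h, Finsupp.single_apply, Ne.symm h]
    rw [← h1, basis_toMatrix_mul_linearMap_toMatrix_mul_basis_toMatrix]
    simp [s, f]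
  · intro i
    have h2 : ∀ n : ℕ, (f ^ n) (b i) = μ i ^ n • b i := by
      intro n
      induction n with
      | zero => simp
      | succ n ih => rw [pow_succ', Module.End.mul_apply, ih, map_smul, hb, smul_smul, pow_succ]
    have h3 := h2 k
    rw [hfk, Module.End.one_apply] at h3
    have h4 : (μ i ^ k - 1) • b i = 0 := by rw [sub_smul, one_smul, ← h3, sub_self]
    have h5 := (smul_eq_zero.1 h4).resolve_right (b.ne_zero i)
    exact Complex.norm_eq_one_of_pow_eq_one (sub_eq_zero.1 h5) hk.ne'

lemma finrank_ker {l : ℕ} (M P Q : Matrix (Fin l) (Fin l) ℂ) (μ : Fin l → ℂ) (hPQ : P * Q = 1)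
    (hM : M = P * Matrix.diagonal μ * Q) :
    finrank ℂ (LinearMap.ker (Matrix.toLin' (M - 1))) =
      (Finset.univ.filter (fun i => μ i = 1)).card := by
  classical
  have h1 : M - 1 = P * Matrix.diagonal (fun i => μ i - 1) * Q := by
    have : Matrix.diagonal (fun i => μ i - 1) = Matrix.diagonal μ - 1 := by
      rw [← Matrix.diagonal_one, Matrix.diagonal_sub]
    rw [this, mul_sub, sub_mul, ← hM, mul_one, hPQ]
  have hP : IsUnit P.det := by
    apply IsUnit.of_mul_eq_one Q.det
    rw [← Matrix.det_mul, hPQ, Matrix.det_one]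
  have hQ : IsUnit Q.det := by
    apply IsUnit.of_mul_eq_one P.det
    rw [mul_comm, ← Matrix.det_mul, hPQ, Matrix.det_one]
  have h2 : (M - 1).rank = Fintype.card {i // μ i - 1 ≠ 0} := by
    rw [h1, Matrix.rank_mul_eq_left_of_isUnit_det _ _ hQ, Matrix.rank_mul_eq_right_of_isUnit_det _ _ hP,
      Matrix.rank_diagonal]
  have h3 := LinearMap.finrank_range_add_finrank_ker (Matrix.toLin' (M - 1))
  rw [finrank_fin_fun] at h3
  have h4 : finrank ℂ (LinearMap.range (Matrix.toLin' (M - 1))) = (M - 1).rank := rfl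
  rw [h4, h2, Fintype.card_subtype] at h3
  have h5 := Finset.card_filter_add_card_filter_not (s := (Finset.univ : Finset (Fin l)))
    (fun i => μ i = 1)
  rw [Finset.card_univ, Fintype.card_fin] at h5
  simp only [sub_ne_zero] at h3
  simp only [ne_eq] at h3
  lia

/-- the action on homogeneous polynomials of degree `k` -/
noncomputable def T {l : ℕ} (k : ℕ) (M : Matrix (Fin l) (Fin l) ℂ) :
    homogeneousSubmodule (Fin l) ℂ k →ₗ[ℂ] homogeneousSubmodule (Fin l) ℂ k :=
  (sb M).toLinearMap.restrict (fun _ hf => sb_hom M hf)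

lemma T_coe {l : ℕ} (k : ℕ) (M : Matrix (Fin l) (Fin l) ℂ) (f : homogeneousSubmodule (Fin l) ℂ k) :
    (T k M f : MvPolynomial (Fin l) ℂ) = sb M f := rfl

lemma T_mul {l : ℕ} (k : ℕ) (M N : Matrix (Fin l) (Fin l) ℂ) :
    T k (M * N) = T k N * T k M := by
  ext1 f
  apply Subtype.ext
  rw [Module.End.mul_apply, T_coe, T_coe, T_coe, sb_sb]

lemma T_one {l : ℕ} (k : ℕ) : T k (1 : Matrix (Fin l) (Fin l) ℂ) = 1 := by
  ext1 f
  apply Subtype.ext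
  rw [T_coe, sb_one]; rfl

lemma sb_diag_monomial {l : ℕ} (μ : Fin l → ℂ) (m : Fin l →₀ ℕ) :
    sb (Matrix.diagonal μ) (monomial m 1) = monomial m (∏ i, μ i ^ m i) := by
  have : ∀ i, sb (Matrix.diagonal μ) (X i) = C (μ i) * X i := by
    intro i
    simp [sb_X, Matrix.diagonal_apply, MvPolynomial.smul_eq_C_mul]
  rw [monomial_eq, map_mul, map_one, map_one, one_mul, Finsupp.prod_fintype _ _ (by simp)]
  simp only [map_prod, map_pow, this, mul_pow, Finset.prod_mul_distrib]
  rw [monomial_eq, Finsupp.prod_fintype _ _ (by simp)]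
  simp

instance {l k : ℕ} : Module.Finite ℂ (homogeneousSubmodule (Fin l) ℂ k) :=
  Module.Finite.iff_fg.2 (homogeneousSubmodule_fg _ _ k)

/-- monomial basis -/
lemma exists_mon_basis (l k : ℕ) :
    ∃ b : Basis (Fz (fun _ : Fin l => 1) k) ℂ (homogeneousSubmodule (Fin l) ℂ k),
      ∀ α, (b α : MvPolynomial (Fin l) ℂ) = monomial (Finsupp.equivFunOnFinite.symm α.1) 1 := by
  have hmem : ∀ α : Fz (fun _ : Fin l => 1) k,
      monomial (Finsupp.equivFunOnFinite.symm α.1) (1 : ℂ) ∈ homogeneousSubmodule (Fin l) ℂ k := by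
    intro α
    rw [mem_homogeneousSubmodule]
    apply isHomogeneous_monomial
    have := (mem_Fz (by simp)).1 α.2
    simpa [Finsupp.degree_eq_sum] using this
  let v : Fz (fun _ : Fin l => 1) k → homogeneousSubmodule (Fin l) ℂ k := fun α => ⟨_, hmem α⟩
  have hli : LinearIndependent ℂ v := by
    apply LinearIndependent.of_comp (homogeneousSubmodule (Fin l) ℂ k).subtype
    have h1 := (basisMonomials (Fin l) ℂ).linearIndependent.comp
      (fun α : Fz (fun _ : Fin l => 1) k => (Finsupp.equivFunOnFinite.symm α.1 : Fin l →₀ ℕ))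
      (Finsupp.equivFunOnFinite.symm.injective.comp Subtype.val_injective)
    convert h1 using 1
    ext1 α
    simp [v]
  have hsp : ⊤ ≤ Submodule.span ℂ (Set.range v) := by
    rintro ⟨f, hf⟩ -
    have h2 : (⟨f, hf⟩ : homogeneousSubmodule (Fin l) ℂ k) =
        ∑ α : Fz (fun _ : Fin l => 1) k, coeff (Finsupp.equivFunOnFinite.symm α.1) f • v α := by
      apply Subtype.ext
      simp only [Submodule.coe_sum, Submodule.coe_smul, v, smul_monomial, smul_eq_mul, mul_one]
      conv_lhs => rw [f.as_sum]
      symm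
      apply Finset.sum_bij_ne_zero (fun α _ _ => Finsupp.equivFunOnFinite.symm α.1)
      · intro α _ hα
        rw [MvPolynomial.mem_support_iff]
        intro h0; apply hα; rw [h0, map_zero]
      · intro α _ _ β _ _ h
        exact Subtype.ext (Finsupp.equivFunOnFinite.symm.injective h)
      · intro m hm hm0
        have hdeg : m.degree = k := by
          by_contra hne
          rw [MvPolynomial.mem_support_iff] at hm
          exact hm (IsHomogeneous.coeff_eq_zero hf hne)
        refine ⟨⟨m, (mem_Fz (by simp)).2 ?_⟩, Finset.mem_univ _, ?_, ?_⟩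
        · simpa [Finsupp.degree_eq_sum] using hdeg
        · simpa using hm0
        · simp
      · intros; rfl
    rw [h2]
    exact Submodule.sum_mem _ fun α _ => Submodule.smul_mem _ _ (Submodule.subset_span ⟨α, rfl⟩)
  exact ⟨Basis.mk hli hsp, fun α => by rw [Basis.mk_apply]⟩

lemma trace_T {l : ℕ} (k : ℕ) (M P Q : Matrix (Fin l) (Fin l) ℂ) (μ : Fin l → ℂ) (hPQ : P * Q = 1)
    (hM : M = P * Matrix.diagonal μ * Q) :
    LinearMap.trace ℂ _ (T k M) = ∑ α ∈ Fz (fun _ : Fin l => 1) k, ∏ i, μ i ^ α i := by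
  classical
  have h1 : LinearMap.trace ℂ _ (T k M) = LinearMap.trace ℂ _ (T k (Matrix.diagonal μ)) := by
    rw [hM, T_mul, T_mul, LinearMap.trace_mul_comm, mul_assoc, ← T_mul,
      mul_eq_one_comm.1 hPQ, T_one, mul_one]
  obtain ⟨b, hb⟩ := exists_mon_basis l k
  rw [h1, LinearMap.trace_eq_matrix_trace ℂ b, Matrix.trace,
    ← Finset.sum_coe_sort (Fz (fun _ : Fin l => 1) k) (fun α => ∏ i, μ i ^ α i)]
  apply Finset.sum_congr rfl
  intro α _
  rw [Matrix.diag_apply, LinearMap.toMatrix_apply]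
  have : T k (Matrix.diagonal μ) (b α) = (∏ i, μ i ^ α.1 i) • b α := by
    apply Subtype.ext
    rw [T_coe, Submodule.coe_smul, hb, sb_diag_monomial, smul_monomial]
    simp
  rw [this, map_smul, Basis.repr_self]
  simp

lemma card_le {l : ℕ} (G : Subgroup (Matrix.GeneralLinearGroup (Fin l) ℂ)) [Fintype G]
    (g : Fin l → MvPolynomial (Fin l) ℂ) (d : Fin l → ℕ)
    (hhom : ∀ i, (g i).IsHomogeneous (d i)) (hjac : jac g ≠ 0)
    (hinv : ∀ M ∈ G, ∀ i, sb (M : Matrix (Fin l) (Fin l) ℂ) (g i) = g i)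
    (hd : ∀ i, 0 < d i) (k : ℕ) :
    ∃ n : ℕ, (Fz d k).card ≤ n ∧ (∑ M : G, LinearMap.trace ℂ _ 
      (T k ((M : Matrix.GeneralLinearGroup (Fin l) ℂ) : Matrix (Fin l) (Fin l) ℂ))) =
        (Fintype.card G : ℂ) * n := by
  let I : Submodule ℂ (homogeneousSubmodule (Fin l) ℂ k) :=
    ⨅ M : G, LinearMap.eqLocus (T k ((M : Matrix.GeneralLinearGroup (Fin l) ℂ) : Matrix (Fin l) (Fin l) ℂ)) LinearMap.id
  have hI : ∀ f, f ∈ I ↔ ∀ M : G, T k ((M : Matrix.GeneralLinearGroup (Fin l) ℂ) : Matrix (Fin l) (Fin l) ℂ) f = f := by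
    intro f
    simp [I, Submodule.mem_iInf, LinearMap.mem_eqLocus]
  have hG : (Fintype.card G : ℂ) ≠ 0 := by exact_mod_cast Fintype.card_ne_zero
  let A : homogeneousSubmodule (Fin l) ℂ k →ₗ[ℂ] homogeneousSubmodule (Fin l) ℂ k :=
    (Fintype.card G : ℂ)⁻¹ • ∑ M : G, T k ((M : Matrix.GeneralLinearGroup (Fin l) ℂ) : Matrix (Fin l) (Fin l) ℂ)
  have hA : LinearMap.IsProj I A := by
    constructor
    · intro f
      rw [hI]
      intro N
      simp only [A, LinearMap.smul_apply, map_smul, LinearMap.sum_apply, map_sum]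
      congr 1
      refine Fintype.sum_equiv (Equiv.mulRight N) _ _ ?_
      intro M
      rw [Equiv.coe_mulRight, Subgroup.coe_mul, Units.val_mul, T_mul, Module.End.mul_apply]
    · intro f hf
      simp only [A, LinearMap.smul_apply, LinearMap.sum_apply, (hI f).1 hf]
      simp only [Finset.sum_const, Finset.card_univ]
      rw [← Nat.cast_smul_eq_nsmul ℂ, smul_smul, inv_mul_cancel₀ hG, one_smul]
  refine ⟨finrank ℂ I, ?_, ?_⟩
  · have hmem : ∀ α : Fz d k, ∏ i, g i ^ α.1 i ∈ homogeneousSubmodule (Fin l) ℂ k := by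
      intro α
      have h := IsHomogeneous.prod Finset.univ (fun i => g i ^ α.1 i) (fun i => d i * α.1 i)
        (fun i _ => (hhom i).pow _)
      rw [(mem_Fz hd).1 α.2] at h
      exact h
    have hmem2 : ∀ α : Fz d k, (⟨_, hmem α⟩ : homogeneousSubmodule (Fin l) ℂ k) ∈ I := by
      intro α
      rw [hI]
      intro M
      apply Subtype.ext
      rw [T_coe]
      simp only [map_prod, map_pow, hinv M.1 M.2]
    let v : Fz d k → I := fun α => ⟨_, hmem2 α⟩
    have hli : LinearIndependent ℂ v := by
      apply LinearIndependent.of_comp ((homogeneousSubmodule (Fin l) ℂ k).subtype ∘ₗ I.subtype)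
      have h1 := (basisMonomials (Fin l) ℂ).linearIndependent.comp
        (fun α : Fz d k => (Finsupp.equivFunOnFinite.symm α.1 : Fin l →₀ ℕ))
        (Finsupp.equivFunOnFinite.symm.injective.comp Subtype.val_injective)
      have h2 := h1.map' (aeval g : MvPolynomial (Fin l) ℂ →ₐ[ℂ] MvPolynomial (Fin l) ℂ).toLinearMap (by
        rw [LinearMap.ker_eq_bot']
        intro p hp
        exact alg_indep g hjac _ p le_rfl hp)
      have heq : ⇑((homogeneousSubmodule (Fin l) ℂ k).subtype ∘ₗ I.subtype) ∘ v =
          ⇑(aeval g : MvPolynomial (Fin l) ℂ →ₐ[ℂ] MvPolynomial (Fin l) ℂ).toLinearMap ∘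
            ⇑(basisMonomials (Fin l) ℂ) ∘
            (fun α : Fz d k => (Finsupp.equivFunOnFinite.symm α.1 : Fin l →₀ ℕ)) := by
        ext1 α
        simp only [Function.comp_apply, coe_basisMonomials, AlgHom.toLinearMap_apply,
          aeval_monomial]
        rw [Finsupp.prod_fintype _ _ (by simp)]
        simp [v]
      rw [heq]
      exact h2
    simpa using hli.fintype_card_le_finrank
  · have : Module.Free ℂ I := Module.Free.of_divisionRing ℂ I
    have : Module.Free ℂ (LinearMap.ker A) := Module.Free.of_divisionRing ℂ (LinearMap.ker A)
    have := hA.trace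
    rw [← this]
    simp only [A, map_smul, map_sum, smul_eq_mul]
    rw [mul_inv_cancel_left₀ hG]

end Springer
namespace Springer

open Filter Topology

lemma sum_le {l : ℕ} (G : Subgroup (Matrix.GeneralLinearGroup (Fin l) ℂ)) [Finite G]
    (R : Finset (Matrix.GeneralLinearGroup (Fin l) ℂ)) (hR : ∀ M, M ∈ R ↔ M ∈ refl G)
    (g : Fin l → MvPolynomial (Fin l) ℂ) (d : Fin l → ℕ)
    (hhom : ∀ i, (g i).IsHomogeneous (d i)) (hjac : jac g ≠ 0)
    (hinv : ∀ M ∈ G, ∀ i, sb (M : Matrix (Fin l) (Fin l) ℂ) (g i) = g i)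
    (hd : ∀ i, 0 < d i) (hdeg : ∏ i, d i = Nat.card G) : ∑ i, (d i - 1) ≤ R.card := by
  classical
  rcases Nat.eq_zero_or_pos l with rfl | hl
  · simp
  have : Fintype G := Fintype.ofFinite G
  have hex : ∀ M : G, ∃ (P Q : Matrix (Fin l) (Fin l) ℂ) (μ : Fin l → ℂ), P * Q = 1 ∧ Q * P = 1 ∧
      ((M : Matrix.GeneralLinearGroup (Fin l) ℂ) : Matrix (Fin l) (Fin l) ℂ) =
        P * Matrix.diagonal μ * Q ∧ ∀ i, ‖μ i‖ = 1 := by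
    intro M
    obtain ⟨k, hk, hk1⟩ := isOfFinOrder_iff_pow_eq_one.1 (isOfFinOrder_of_finite M)
    have hk2 : (M : Matrix.GeneralLinearGroup (Fin l) ℂ) ^ k = 1 := by
      simpa using congrArg Subtype.val hk1
    have hk3 := congrArg
      (fun A : Matrix.GeneralLinearGroup (Fin l) ℂ => (A : Matrix (Fin l) (Fin l) ℂ)) hk2
    simp only [Units.val_pow_eq_pow_val, Units.val_one] at hk3
    exact exists_diag _ k hk hk3
  choose P Q μ hPQ hQP hM hμ using hex
  have hfr := fun M : G => finrank_ker _ (P M) (Q M) (μ M) (hPQ M) (hM M)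
  have hμ1 : ∀ i, μ 1 i = 1 := by
    have h1 := hfr 1
    have h2 : ((((1 : G) : Matrix.GeneralLinearGroup (Fin l) ℂ) : Matrix (Fin l) (Fin l) ℂ) - 1)
        = 0 := by simp
    rw [h2, map_zero, LinearMap.ker_zero, finrank_top, finrank_fin_fun] at h1
    have h3 : Finset.univ.filter (fun i => μ 1 i = 1) = Finset.univ := by
      apply Finset.eq_univ_of_card
      rw [← h1, Fintype.card_fin]
    intro i
    have : i ∈ Finset.univ.filter (fun i => μ 1 i = 1) := by rw [h3]; exact Finset.mem_univ _
    exact (Finset.mem_filter.1 this).2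
  have hμne : ∀ M : G, M ≠ 1 → (Finset.univ.filter (fun i => μ M i = 1)).card + 1 ≤ l := by
    intro M hne
    by_contra hcon
    apply hne
    have h3 : Finset.univ.filter (fun i => μ M i = 1) = Finset.univ := by
      apply Finset.eq_univ_of_card
      have := Finset.card_le_univ (Finset.univ.filter (fun i => μ M i = 1))
      rw [Fintype.card_fin] at *
      lia
    have h4 : μ M = fun _ => 1 := by
      ext1 i
      have : i ∈ Finset.univ.filter (fun i => μ M i = 1) := by rw [h3]; exact Finset.mem_univ _
      exact (Finset.mem_filter.1 this).2
    apply Subtype.ext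
    apply Units.ext
    rw [hM M, h4, Matrix.diagonal_one, mul_one, hPQ]
    rfl
  have key : ∀ t : ℝ, 0 < t → t < 1 → (Fintype.card G : ℝ) * ∏ i, (1 - t ^ d i)⁻¹ ≤
      ∑ M : G, (∏ i, (1 - μ M i * (t : ℂ))⁻¹).re := by
    intro t ht0 ht1
    have hs1 := hasSum_sum (s := (Finset.univ : Finset G)) (fun M _ =>
      hasSum_graded (fun _ : Fin l => 1) (by simp) (μ M) (hμ M) t ht0 ht1)
    have hs2 := Complex.hasSum_re hs1
    have hs3 := (Complex.hasSum_re
      (hasSum_graded d hd (fun _ => 1) (by simp) t ht0 ht1)).mul_left (Fintype.card G : ℝ)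
    have hre : (∏ i, (1 - (1 : ℂ) * (t : ℂ) ^ d i)⁻¹).re = ∏ i, (1 - t ^ d i)⁻¹ := by
      rw [← Complex.ofReal_re (∏ i, (1 - t ^ d i)⁻¹)]
      congr 1
      push_cast
      simp
    rw [hre] at hs3
    have hle := hasSum_le (fun k => ?_) hs3 hs2
    · simpa using hle
    · obtain ⟨n, hn1, hn2⟩ := card_le G g d hhom hjac hinv hd k
      simp only [fun M : G => trace_T k _ (P M) (Q M) (μ M) (hPQ M) (hM M)] at hn2
      rw [← Finset.sum_mul, hn2]
      have e1 : ((∑ α ∈ Fz d k, ∏ i, (1 : ℂ) ^ α i) * (t : ℂ) ^ k).re = (Fz d k).card * t ^ k := by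
        simp only [one_pow, Finset.prod_const_one, Finset.sum_const, nsmul_eq_mul, mul_one]
        exact_mod_cast Complex.ofReal_re _
      have e2 : ((Fintype.card G : ℂ) * n * (t : ℂ) ^ k).re = Fintype.card G * (n * t ^ k) := by
        rw [← mul_assoc]
        exact_mod_cast Complex.ofReal_re _
      rw [e1, e2]
      have : ((Fz d k).card : ℝ) ≤ n := by exact_mod_cast hn1
      gcongr
  have hT1 := tendsto_lhs hl d hd
  have hT2 := tendsto_finsetSum (Finset.univ.erase (1 : G)) (fun M hM' =>
    tendsto_term (μ M) (hμ M) (hμne M (Finset.ne_of_mem_erase hM')))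
  have hlim : ∑ i, ((d i : ℝ) - 1) / 2 ≤ ∑ M ∈ Finset.univ.erase (1 : G),
      (if (Finset.univ.filter (fun i => μ M i = 1)).card = l - 1 then (1 / 2 : ℝ) else 0) := by
    refine le_of_tendsto_of_tendsto hT1 hT2 ?_
    have hev : ∀ᶠ t : ℝ in 𝓝[<] 1, t ∈ Set.Ioo (0 : ℝ) 1 :=
      Ioo_mem_nhdsLT (by norm_num)
    filter_upwards [hev] with t ht
    have hk := key t ht.1 ht.2
    rw [← Finset.add_sum_erase _ _ (Finset.mem_univ (1 : G))] at hk
    have hre : (∏ i, (1 - μ 1 i * (t : ℂ))⁻¹).re = ∏ _i : Fin l, (1 - t)⁻¹ := by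
      rw [← Complex.ofReal_re (∏ _i : Fin l, (1 - t)⁻¹)]
      congr 1
      push_cast
      simp [hμ1]
    rw [hre] at hk
    have hrw : ∑ M ∈ Finset.univ.erase (1 : G),
        (((1 - t : ℝ) : ℂ) ^ (l - 1) * ∏ i, (1 - μ M i * (t : ℂ))⁻¹).re =
        (∑ M ∈ Finset.univ.erase (1 : G), (∏ i, (1 - μ M i * (t : ℂ))⁻¹).re)
          * (1 - t) ^ (l - 1) := by
      rw [Finset.sum_mul]
      apply Finset.sum_congr rfl
      intro M _
      rw [← Complex.ofReal_pow, Complex.re_ofReal_mul, mul_comm]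
    rw [hrw, hdeg, Nat.card_eq_fintype_card]
    apply mul_le_mul_of_nonneg_right
    · linarith
    · exact pow_nonneg (by linarith [ht.2]) _
  rw [← Finset.sum_filter, Finset.sum_const, ← Finset.sum_div, nsmul_eq_mul] at hlim
  have hcard : (Finset.filter (fun M => (Finset.univ.filter (fun i => μ M i = 1)).card = l - 1)
      (Finset.univ.erase (1 : G))).card ≤ R.card := by
    apply Finset.card_le_card_of_injOn (fun M : G => (M : Matrix.GeneralLinearGroup (Fin l) ℂ))
    · intro M hM'
      have h := Finset.mem_filter.1 (Finset.mem_coe.1 hM')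
      rw [Finset.mem_coe, hR]
      refine ⟨M.2, ?_, ?_⟩
      · intro h1
        exact Finset.ne_of_mem_erase h.1 (Subtype.ext h1)
      · rw [hfr M]; exact h.2
    · exact Subtype.val_injective.injOn
  have hcast : ((∑ i, (d i - 1) : ℕ) : ℝ) = ∑ i, ((d i : ℝ) - 1) := by
    rw [Nat.cast_sum]
    apply Finset.sum_congr rfl
    intro i _
    rw [Nat.cast_sub (hd i), Nat.cast_one]
  have hcard' : ((Finset.filter (fun M => (Finset.univ.filter (fun i => μ M i = 1)).card = l - 1)
      (Finset.univ.erase (1 : G))).card : ℝ) ≤ R.card := by exact_mod_cast hcard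
  have : ((∑ i, (d i - 1) : ℕ) : ℝ) ≤ R.card := by
    rw [hcast]; linarith
  exact_mod_cast this

end Springer

/-- Springer's criterion: if `C ⊆ GL_l(ℂ)` is a finite group
generated by reflections, `g₁,…,g_l` are homogeneous `C`-invariant polynomials
of degrees `d₁,…,d_l` with `∏ dᵢ = |C|` whose Jacobian determinant is not
identically zero, then the ring of `C`-invariants is exactly `ℂ[g₁,…,g_l]`. -/
theorem stmt17 (l : ℕ) (C : Subgroup (Matrix.GeneralLinearGroup (Fin l) ℂ))
    [Finite C]
    (hrefl : Subgroup.closure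
        {M : Matrix.GeneralLinearGroup (Fin l) ℂ | M ∈ C ∧ M ≠ 1 ∧
          finrank ℂ (LinearMap.ker (Matrix.toLin'
            ((M : Matrix (Fin l) (Fin l) ℂ) - 1))) = l - 1} = C)
    (g : Fin l → MvPolynomial (Fin l) ℂ) (d : Fin l → ℕ)
    (hhom : ∀ i, (g i).IsHomogeneous (d i))
    (hjac : (Matrix.of fun i j => pderiv j (g i)).det ≠ 0)
    (hinv : ∀ M ∈ C, ∀ i, matrixSubst (M : Matrix (Fin l) (Fin l) ℂ) (g i) = g i)
    (hdeg : ∏ i, d i = Nat.card C) :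
    {f : MvPolynomial (Fin l) ℂ |
        ∀ M ∈ C, matrixSubst (M : Matrix (Fin l) (Fin l) ℂ) f = f}
      = (Algebra.adjoin ℂ (Set.range g) : Set (MvPolynomial (Fin l) ℂ)) := by
  have hd : ∀ i, 0 < d i := by
    intro i
    apply Nat.pos_of_ne_zero
    have h : ∏ i, d i ≠ 0 := by rw [hdeg]; exact Nat.card_pos.ne'
    exact Finset.prod_ne_zero_iff.1 h i (Finset.mem_univ i)
  have hfin : (Springer.refl C).Finite :=
    (Set.toFinite (C : Set (Matrix.GeneralLinearGroup (Fin l) ℂ))).subset fun M hM => hM.1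
  have hle := Springer.sum_le C hfin.toFinset (fun M => hfin.mem_toFinset) g d hhom hjac hinv hd hdeg
  apply Set.Subset.antisymm
  · intro f hf
    exact Springer.final C hfin.toFinset (fun M => hfin.mem_toFinset) g d hhom hjac hinv hd hle f hf
  · intro f hf M hM
    change Springer.sb (M : Matrix (Fin l) (Fin l) ℂ) f = f
    have hadj : Algebra.adjoin ℂ (Set.range g) ≤
        AlgHom.equalizer (Springer.sb (M : Matrix (Fin l) (Fin l) ℂ)) (AlgHom.id ℂ _) := by
      apply Algebra.adjoin_le
      rintro _ ⟨i, rfl⟩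
      exact hinv M hM i
    exact hadj hf
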